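/- arXiv:2011.05468 — 3 statements merged into one kernel-verified Lean document; each statement's English description precedes it below -/
import Mathlib

section
/- Let (X, μ) be a measure space, V : X → [0, ∞) a measurable function, n a natural number, and α, C > 0 constants such that ∫_{{V ≤ λ}} (λ − V)^{n/2} dμ ≤ C·λ^α for every λ ≥ 0. Then for every real k ≥ 0, the function x ↦ exp(−V(x))·V(x)^{k/2} is μ-integrable; in fact ∫_X exp(−V)·V^{k/2} dμ ≤ C_k for a constant C_k depending only on k, n, α and C. -/
open MeasureTheory

/-- **Integrability of `exp(−V)·V^{k/2}`** (Lemma 2.1, part 2, of "Witten Deformation on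
Non-compact Manifolds"): there is a constant `Ck` depending only on `k`, `n`, `α`, `C` such
that for any measure space `(X, μ)` and measurable `V : X → [0, ∞)` satisfying the
polynomial tameness bound `∫_{{V ≤ λ}} (λ − V)^{n/2} dμ ≤ C·λ^α` for all `λ ≥ 0`,
the function `x ↦ exp(−V(x))·V(x)^{k/2}` is `μ`-integrable with integral at most `Ck`. -/
theorem integrable_exp_neg_V_mul_V_pow
    (n : ℕ) (α C k : ℝ) (hα : 0 < α) (hC : 0 < C) (hk : 0 ≤ k) :
    ∃ Ck : ℝ, ∀ (X : Type*) (_ : MeasurableSpace X) (μ : Measure X) (V : X → ℝ),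
      Measurable V → (∀ x, 0 ≤ V x) →
      (∀ lam : ℝ, 0 ≤ lam →
        ∫⁻ x in {x | V x ≤ lam}, ENNReal.ofReal ((lam - V x) ^ ((n : ℝ) / 2)) ∂μ
          ≤ ENNReal.ofReal (C * lam ^ α)) →
      Integrable (fun x => Real.exp (-V x) * V x ^ (k / 2)) μ ∧
        ∫ x, Real.exp (-V x) * V x ^ (k / 2) ∂μ ≤ Ck := by
  set a : ℕ → ℝ := fun l => Real.exp (-(l : ℝ)) * ((l : ℝ) + 1) ^ (k / 2) with ha
  have ha0 : ∀ l, 0 ≤ a l := fun l => by simp only [ha]; positivity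
  have hb0 : ∀ l : ℕ, 0 ≤ C * ((l : ℝ) + 2) ^ α := fun l => by positivity
  have hsum : Summable (fun l : ℕ => a l * (C * ((l : ℝ) + 2) ^ α)) := by
    obtain ⟨N, hN⟩ := exists_nat_ge (k / 2 + α)
    have h1 := Real.summable_pow_mul_exp_neg_nat_mul N (r := 1) one_pos
    have h2 := ((summable_nat_add_iff 2).2 h1).mul_left (C * Real.exp 2)
    refine Summable.of_nonneg_of_le (fun l => mul_nonneg (ha0 l) (hb0 l)) (fun l => ?_) h2
    have hl : (0 : ℝ) ≤ l := Nat.cast_nonneg l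
    have e1 : ((l : ℝ) + 1) ^ (k / 2) ≤ ((l : ℝ) + 2) ^ (k / 2) :=
      Real.rpow_le_rpow (by linarith) (by linarith) (by linarith)
    have e2 : ((l : ℝ) + 2) ^ (k / 2) * ((l : ℝ) + 2) ^ α ≤ ((l : ℝ) + 2) ^ N := by
      rw [← Real.rpow_add (by linarith), ← Real.rpow_natCast]
      exact Real.rpow_le_rpow_of_exponent_le (by linarith) hN
    have e3 : Real.exp 2 * Real.exp (-1 * ((l + 2 : ℕ) : ℝ)) = Real.exp (-(l : ℝ)) := by
      rw [← Real.exp_add]; congr 1; push_cast; ring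
    calc a l * (C * ((l : ℝ) + 2) ^ α)
        = C * Real.exp (-(l : ℝ)) * (((l : ℝ) + 1) ^ (k / 2) * ((l : ℝ) + 2) ^ α) := by
          simp only [ha]; ring
      _ ≤ C * Real.exp (-(l : ℝ)) * ((l : ℝ) + 2) ^ N := by
          gcongr
          exact le_trans (by gcongr) e2
      _ = _ := by rw [← e3]; push_cast; ring
  refine ⟨∑' l : ℕ, a l * (C * ((l : ℝ) + 2) ^ α), ?_⟩
  intro X _ μ V hV hV0 hT
  have hf0 : ∀ x, 0 ≤ Real.exp (-V x) * V x ^ (k / 2) := fun x =>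
    mul_nonneg (Real.exp_pos _).le (Real.rpow_nonneg (hV0 x) _)
  have hfm : Measurable (fun x => Real.exp (-V x) * V x ^ (k / 2)) := by fun_prop
  set g : ℕ → X → ENNReal := fun l => {x | V x ≤ (l : ℝ) + 2}.indicator
    (fun x => ENNReal.ofReal (((l : ℝ) + 2 - V x) ^ ((n : ℝ) / 2))) with hg
  have hms : ∀ l : ℕ, MeasurableSet {x | V x ≤ (l : ℝ) + 2} := fun l =>
    measurableSet_le hV measurable_const
  have hgm : ∀ l, Measurable (g l) := fun l => by
    refine Measurable.indicator ?_ (hms l)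
    fun_prop
  have hpt : ∀ x, ENNReal.ofReal (Real.exp (-V x) * V x ^ (k / 2))
      ≤ ∑' l, ENNReal.ofReal (a l) * g l x := by
    intro x
    refine le_trans ?_ (ENNReal.le_tsum ⌊V x⌋₊)
    have h1 := Nat.floor_le (hV0 x)
    have h2 := Nat.lt_floor_add_one (V x)
    have hx : x ∈ {x | V x ≤ ((⌊V x⌋₊ : ℕ) : ℝ) + 2} := by
      show V x ≤ _
      linarith
    have h3 : (1 : ENNReal) ≤ g ⌊V x⌋₊ x := by
      simp only [hg]
      rw [Set.indicator_of_mem (by show V x ≤ _; linarith), ENNReal.one_le_ofReal]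
      exact Real.one_le_rpow (by linarith) (by positivity)
    refine le_trans (ENNReal.ofReal_le_ofReal ?_) (le_mul_of_one_le_right' h3)
    simp only [ha]
    exact mul_le_mul (Real.exp_le_exp.2 (by linarith))
      (Real.rpow_le_rpow (hV0 x) h2.le (by linarith)) (Real.rpow_nonneg (hV0 x) _)
      (Real.exp_pos _).le
  have hlin : ∫⁻ x, ENNReal.ofReal (Real.exp (-V x) * V x ^ (k / 2)) ∂μ
      ≤ ENNReal.ofReal (∑' l : ℕ, a l * (C * ((l : ℝ) + 2) ^ α)) := by
    calc _ ≤ ∫⁻ x, ∑' l, ENNReal.ofReal (a l) * g l x ∂μ := lintegral_mono hpt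
      _ = ∑' l, ENNReal.ofReal (a l) * ∫⁻ x, g l x ∂μ := by
          rw [lintegral_tsum (fun l => ((hgm l).const_mul _).aemeasurable)]
          congr 1; ext l
          rw [lintegral_const_mul _ (hgm l)]
      _ ≤ ∑' l : ℕ, ENNReal.ofReal (a l * (C * ((l : ℝ) + 2) ^ α)) := by
          refine ENNReal.tsum_le_tsum fun l => ?_
          rw [ENNReal.ofReal_mul (ha0 l)]
          gcongr
          simp only [hg]
          rw [lintegral_indicator (hms l)]
          exact hT _ (by positivity)
      _ = _ := (ENNReal.ofReal_tsum_of_nonneg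
          (fun l => mul_nonneg (ha0 l) (hb0 l)) hsum).symm
  refine ⟨⟨hfm.aestronglyMeasurable, ?_⟩, ?_⟩
  · rw [hasFiniteIntegral_iff_ofReal (Filter.Eventually.of_forall hf0)]
    exact hlin.trans_lt ENNReal.ofReal_lt_top
  · rw [integral_eq_lintegral_of_nonneg_ae (Filter.Eventually.of_forall hf0)
      hfm.aestronglyMeasurable]
    exact ENNReal.toReal_le_of_le_ofReal
      (tsum_nonneg fun l => mul_nonneg (ha0 l) (hb0 l)) hlin
end

section
/- Let n ≥ 1 and consider the exterior algebra Λ*(ℝⁿ) with standard orthonormal basis e_1, …, e_n of ℝⁿ. For each i define the linear endomorphisms c(e_i) = e_i ∧ · − ι_{e_i} and ĉ(e_i) = e_i ∧ · + ι_{e_i} of Λ*(ℝⁿ), where ι_{e_i} is interior multiplication (contraction) by e_i, and define the supertrace of an endomorphism A of Λ*(ℝⁿ) by tr_s(A) = Σ_{k=0}^{n} (−1)^k tr(A restricted to Λ^k(ℝⁿ)). Then for subsets I = {i_1 < … < i_p} and J = {j_1 < … < j_q} of {1, …, n}, writing c(e_I) = c(e_{i_1})⋯c(e_{i_p}) and ĉ(e_J)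 = ĉ(e_{j_1})⋯ĉ(e_{j_q}), one has tr_s(c(e_I)·ĉ(e_J)) = (−1)^{n(n+1)/2}·2ⁿ if I = J = {1, 2, …, n}, and tr_s(c(e_I)·ĉ(e_J)) = 0 otherwise. -/
noncomputable section

open ExteriorAlgebra

/-- The `i`-th standard basis vector of `ℝⁿ`. -/
def stdVec (n : ℕ) (i : Fin n) : EuclideanSpace ℝ (Fin n) := EuclideanSpace.single i 1

/-- Exterior (wedge) multiplication by `e_i` on `Λ*(ℝⁿ)`. -/
def wedgeOp (n : ℕ) (i : Fin n) :
    Module.End ℝ (ExteriorAlgebra ℝ (EuclideanSpace ℝ (Fin n))) :=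
  LinearMap.mulLeft ℝ (ι ℝ (stdVec n i))

/-- Interior multiplication (contraction) `ι_{e_i}` on `Λ*(ℝⁿ)`, i.e. contraction by the
dual basis vector (equivalently, by `⟨e_i, ·⟩`, since the basis is orthonormal). -/
def intOp (n : ℕ) (i : Fin n) :
    Module.End ℝ (ExteriorAlgebra ℝ (EuclideanSpace ℝ (Fin n))) :=
  CliffordAlgebra.contractLeft ((EuclideanSpace.basisFun (Fin n) ℝ).toBasis.coord i)

/-- The Clifford action `c(e_i) = e_i ∧ · − ι_{e_i}`. -/
def cOp (n : ℕ) (i : Fin n) :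
    Module.End ℝ (ExteriorAlgebra ℝ (EuclideanSpace ℝ (Fin n))) :=
  wedgeOp n i - intOp n i

/-- The anti-Clifford action `ĉ(e_i) = e_i ∧ · + ι_{e_i}`. -/
def cHatOp (n : ℕ) (i : Fin n) :
    Module.End ℝ (ExteriorAlgebra ℝ (EuclideanSpace ℝ (Fin n))) :=
  wedgeOp n i + intOp n i

/-- `c(e_I) = c(e_{i_1})⋯c(e_{i_p})` for `I = {i_1 < … < i_p}`. -/
def cProd (n : ℕ) (I : Finset (Fin n)) :
    Module.End ℝ (ExteriorAlgebra ℝ (EuclideanSpace ℝ (Fin n))) :=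
  ((I.sort (· ≤ ·)).map (cOp n)).prod

/-- `ĉ(e_J) = ĉ(e_{j_1})⋯ĉ(e_{j_q})` for `J = {j_1 < … < j_q}`. -/
def cHatProd (n : ℕ) (J : Finset (Fin n)) :
    Module.End ℝ (ExteriorAlgebra ℝ (EuclideanSpace ℝ (Fin n))) :=
  ((J.sort (· ≤ ·)).map (cHatOp n)).prod

/-- The supertrace `tr_s(A) = Σ_{k=0}^{n} (−1)^k tr(A restricted to Λ^k(ℝⁿ))`, where the
restriction of `A` to the degree-`k` component is realized by compressing with the graded
projection `π_k` of the exterior algebra. -/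
def straceExt (n : ℕ)
    (A : Module.End ℝ (ExteriorAlgebra ℝ (EuclideanSpace ℝ (Fin n)))) : ℝ :=
  ∑ k ∈ Finset.range (n + 1), (-1 : ℝ) ^ k *
    LinearMap.trace ℝ _
      (GradedAlgebra.proj (fun i : ℕ => ⋀[ℝ]^i (EuclideanSpace ℝ (Fin n))) k ∘ₗ A ∘ₗ
        GradedAlgebra.proj (fun i : ℕ => ⋀[ℝ]^i (EuclideanSpace ℝ (Fin n))) k)

section AbstractLemmas

variable {R : Type*} [Ring R] [Algebra ℝ R]

lemma aux_anti_list (x : R) (l : List R) (h : ∀ y ∈ l, x * y = -(y * x)) :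
    x * l.prod = (-1 : ℝ) ^ l.length • (l.prod * x) := by
  induction l with
  | nil => simp
  | cons a t ih =>
    have ha := h a (by simp)
    have ht := ih (fun y hy => h y (by simp [hy]))
    rw [List.prod_cons, ← mul_assoc, ha, neg_mul, mul_assoc a x, ht, List.length_cons, pow_succ]
    simp [mul_assoc]

lemma aux_anti_mem {ι : Type*} (f : ι → R) (hf : ∀ i j, i ≠ j → f i * f j = -(f j * f i))
    (i : ι) (l : List ι) (hl : l.Nodup) (hi : i ∈ l) :
    f i * (l.map f).prod = -((-1 : ℝ) ^ l.length • ((l.map f).prod * f i)) := by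
  induction l with
  | nil => simp at hi
  | cons a t ih =>
    rw [List.nodup_cons] at hl
    rw [List.map_cons, List.prod_cons, List.length_cons, pow_succ]
    by_cases hia : i = a
    · subst hia
      have := aux_anti_list (f i) (t.map f) (by
        intro y hy
        obtain ⟨j, hj, rfl⟩ := List.mem_map.1 hy
        exact hf _ _ (fun h => hl.1 (h ▸ hj)))
      rw [List.length_map] at this
      rw [mul_assoc (f i) _ (f i), mul_neg_one, neg_smul, neg_neg, ← mul_smul_comm, this]
    · have hit : i ∈ t := by simpa [hia] using hi
      rw [← mul_assoc, hf i a hia, neg_mul, mul_assoc, ih hl.2 hit]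
      simp [mul_assoc]

lemma aux_anti_notMem {ι : Type*} (f : ι → R) (hf : ∀ i j, i ≠ j → f i * f j = -(f j * f i))
    (i : ι) (l : List ι) (hi : i ∉ l) :
    f i * (l.map f).prod = (-1 : ℝ) ^ l.length • ((l.map f).prod * f i) := by
  have := aux_anti_list (f i) (l.map f) (by
    intro y hy
    obtain ⟨j, hj, rfl⟩ := List.mem_map.1 hy
    exact hf _ _ (fun h => hi (h ▸ hj)))
  rwa [List.length_map] at this

lemma aux_anti_all {ι : Type*} (f : ι → R) (x : R) (hf : ∀ j, x * f j = -(f j * x))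
    (l : List ι) :
    x * (l.map f).prod = (-1 : ℝ) ^ l.length • ((l.map f).prod * x) := by
  have := aux_anti_list x (l.map f) (by
    intro y hy
    obtain ⟨j, hj, rfl⟩ := List.mem_map.1 hy
    exact hf _)
  rwa [List.length_map] at this

lemma aux_two (x A B : R) (a b : ℝ) (hA : x * A = a • (A * x)) (hB : x * B = b • (B * x)) :
    x * (A * B) = (a * b) • (A * B * x) := by
  rw [← mul_assoc, hA, smul_mul_assoc, mul_assoc, hB, mul_smul_comm, smul_smul, mul_assoc]

end AbstractLemmas

abbrev ExtA (n : ℕ) := ExteriorAlgebra ℝ (EuclideanSpace ℝ (Fin n))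

lemma aux_coord (n : ℕ) (i j : Fin n) :
    (EuclideanSpace.basisFun (Fin n) ℝ).toBasis.coord i (stdVec n j) = if i = j then 1 else 0 := by
  simp [stdVec, Pi.single_apply]

lemma aux_ww (n : ℕ) (i j : Fin n) : wedgeOp n i * wedgeOp n j = -(wedgeOp n j * wedgeOp n i) := by
  refine LinearMap.ext fun x => ?_
  have h := ExteriorAlgebra.ι_add_mul_swap (R := ℝ) (stdVec n i) (stdVec n j)
  simp only [wedgeOp, Module.End.mul_apply, LinearMap.neg_apply, LinearMap.mulLeft_apply,
    ← mul_assoc]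
  rw [eq_neg_of_add_eq_zero_left h, neg_mul]

lemma aux_ii (n : ℕ) (i j : Fin n) : intOp n i * intOp n j = -(intOp n j * intOp n i) := by
  refine LinearMap.ext fun x => ?_
  exact CliffordAlgebra.contractLeft_comm _ _ x

lemma aux_iw (n : ℕ) (i j : Fin n) :
    intOp n i * wedgeOp n j = (if i = j then 1 else 0) - wedgeOp n j * intOp n i := by
  refine LinearMap.ext fun x => ?_
  have h := CliffordAlgebra.contractLeft_ι_mul (Q := (0 : QuadraticForm ℝ (EuclideanSpace ℝ (Fin n))))
    (d := (EuclideanSpace.basisFun (Fin n) ℝ).toBasis.coord i) (stdVec n j) x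
  rw [aux_coord] at h
  refine h.trans ?_
  split_ifs <;> simp <;> rfl

lemma aux_cc (n : ℕ) (i j : Fin n) (h : i ≠ j) : cOp n i * cOp n j = -(cOp n j * cOp n i) := by
  have h1 := aux_ww n i j
  have h2 := aux_ii n i j
  have h3 := aux_iw n i j
  have h4 := aux_iw n j i
  rw [if_neg h] at h3
  rw [if_neg h.symm] at h4
  simp only [cOp, mul_sub, sub_mul, h1, h2, h3, h4]
  abel

lemma aux_hh (n : ℕ) (i j : Fin n) (h : i ≠ j) :
    cHatOp n i * cHatOp n j = -(cHatOp n j * cHatOp n i) := by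
  have h1 := aux_ww n i j
  have h2 := aux_ii n i j
  have h3 := aux_iw n i j
  have h4 := aux_iw n j i
  rw [if_neg h] at h3
  rw [if_neg h.symm] at h4
  simp only [cHatOp, mul_add, add_mul, h1, h2, h3, h4]
  abel

lemma aux_ww0 (n : ℕ) (i : Fin n) : wedgeOp n i * wedgeOp n i = 0 := by
  refine LinearMap.ext fun x => ?_
  simp [wedgeOp, ← mul_assoc]

lemma aux_ii0 (n : ℕ) (i : Fin n) : intOp n i * intOp n i = 0 := by
  refine LinearMap.ext fun x => ?_
  exact CliffordAlgebra.contractLeft_contractLeft _ x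

lemma aux_ch (n : ℕ) (i j : Fin n) : cOp n i * cHatOp n j = -(cHatOp n j * cOp n i) := by
  have h1 := aux_ww n i j
  have h2 := aux_ii n i j
  have h3 := aux_iw n i j
  have h4 := aux_iw n j i
  simp only [cOp, cHatOp, mul_add, add_mul, mul_sub, sub_mul, h1, h2, h3, h4, eq_comm (a := j)]
  abel

lemma aux_hc (n : ℕ) (i j : Fin n) : cHatOp n i * cOp n j = -(cOp n j * cHatOp n i) := by
  rw [aux_ch, neg_neg]

lemma aux_cc1 (n : ℕ) (i : Fin n) : cOp n i * cOp n i = -1 := by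
  have h3 := aux_iw n i i
  rw [if_pos rfl] at h3
  simp only [cOp, mul_sub, sub_mul, aux_ww0, aux_ii0, h3]
  abel

lemma aux_hh1 (n : ℕ) (i : Fin n) : cHatOp n i * cHatOp n i = 1 := by
  have h3 := aux_iw n i i
  rw [if_pos rfl] at h3
  simp only [cHatOp, mul_add, add_mul, aux_ww0, aux_ii0, h3]
  abel

/-- grading involution -/
def epsOp (n : ℕ) : Module.End ℝ (ExtA n) :=
  (CliffordAlgebra.involute (Q := (0 : QuadraticForm ℝ (EuclideanSpace ℝ (Fin n))))).toLinearMap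

lemma eps_ι_mul (n : ℕ) (v : EuclideanSpace ℝ (Fin n)) (x : ExtA n) :
    epsOp n (ι ℝ v * x) = -(ι ℝ v * epsOp n x) := by
  have := map_mul (CliffordAlgebra.involute (Q := (0 : QuadraticForm ℝ (EuclideanSpace ℝ (Fin n)))))
    (CliffordAlgebra.ι _ v) x
  rw [CliffordAlgebra.involute_ι, neg_mul] at this
  exact this

lemma eps_algebraMap (n : ℕ) (r : ℝ) : epsOp n (algebraMap ℝ _ r) = algebraMap ℝ _ r :=
  AlgHom.commutes _ r

lemma eps_eps (n : ℕ) : epsOp n * epsOp n = 1 :=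
  LinearMap.ext fun x => CliffordAlgebra.involute_involute x

lemma eps_w (n : ℕ) (i : Fin n) : epsOp n * wedgeOp n i = -(wedgeOp n i * epsOp n) :=
  LinearMap.ext fun x => eps_ι_mul n _ x

lemma eps_i (n : ℕ) (i : Fin n) : epsOp n * intOp n i = -(intOp n i * epsOp n) := by
  refine LinearMap.ext fun x => ?_
  change epsOp n (intOp n i x) = -(intOp n i (epsOp n x))
  induction x using CliffordAlgebra.left_induction with
  | algebraMap r =>
    have h : intOp n i (algebraMap ℝ (ExtA n) r) = 0 := CliffordAlgebra.contractLeft_algebraMap _ _ r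
    have h2 := eps_algebraMap n r
    erw [h, h2, h]
    simp
  | add x y hx hy => rw [map_add, map_add, map_add, map_add, hx, hy, neg_add]
  | ι_mul x v hx =>
    have key : ∀ y : ExtA n, intOp n i (ι ℝ v * y) =
        ((EuclideanSpace.basisFun (Fin n) ℝ).toBasis.coord i v) • y - ι ℝ v * intOp n i y :=
      fun y => CliffordAlgebra.contractLeft_ι_mul _ v y
    change epsOp n (intOp n i (ι ℝ v * x)) = -(intOp n i (epsOp n (ι ℝ v * x)))
    rw [eps_ι_mul, key, map_neg, key, map_sub, eps_ι_mul, map_smul, hx]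
    simp

lemma eps_c (n : ℕ) (i : Fin n) : epsOp n * cOp n i = -(cOp n i * epsOp n) := by
  simp only [cOp, mul_sub, sub_mul, eps_w, eps_i]; abel

lemma eps_h (n : ℕ) (i : Fin n) : epsOp n * cHatOp n i = -(cHatOp n i * epsOp n) := by
  simp only [cHatOp, mul_add, add_mul, eps_w, eps_i]; abel

lemma eps_pow (n k : ℕ) (x : ExtA n) (hx : x ∈ ⋀[ℝ]^k (EuclideanSpace ℝ (Fin n))) :
    epsOp n x = (-1 : ℝ) ^ k • x := by
  induction hx using Submodule.pow_induction_on_left' with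
  | algebraMap r => rw [eps_algebraMap]; simp
  | add x y i hx hy h1 h2 => rw [map_add, h1, h2, smul_add]
  | mem_mul m hm i x hx h =>
    obtain ⟨v, rfl⟩ := hm
    rw [eps_ι_mul, h, pow_succ]
    simp

lemma ext_zero (n k : ℕ) (hk : n < k) (x : ExtA n)
    (hx : x ∈ ⋀[ℝ]^k (EuclideanSpace ℝ (Fin n))) : x = 0 := by
  have h := exteriorPower.finrank_eq ℝ k (M := EuclideanSpace ℝ (Fin n))
  rw [finrank_euclideanSpace_fin, Nat.choose_eq_zero_of_lt hk] at h
  have := Module.finrank_zero_iff.1 h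
  exact congrArg Subtype.val (Subsingleton.elim (⟨x, hx⟩ : ⋀[ℝ]^k (EuclideanSpace ℝ (Fin n))) 0)

lemma eps_sum (n : ℕ) : epsOp n = ∑ k ∈ Finset.range (n + 1), (-1 : ℝ) ^ k •
    GradedAlgebra.proj (fun i : ℕ => ⋀[ℝ]^i (EuclideanSpace ℝ (Fin n))) k := by
  refine LinearMap.ext fun x => ?_
  induction x using DirectSum.Decomposition.inductionOn
    (fun i : ℕ => ⋀[ℝ]^i (EuclideanSpace ℝ (Fin n))) with
  | zero => simp
  | add x y hx hy => rw [map_add, map_add, hx, hy]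
  | @homogeneous k m =>
    rw [eps_pow n k m m.2]
    simp only [LinearMap.sum_apply, LinearMap.smul_apply, GradedAlgebra.proj_apply]
    rw [Finset.sum_eq_single k]
    · rw [DirectSum.decompose_of_mem_same (fun i : ℕ => ⋀[ℝ]^i (EuclideanSpace ℝ (Fin n))) m.2]
    · intro j _ hj
      rw [DirectSum.decompose_of_mem_ne (fun i : ℕ => ⋀[ℝ]^i (EuclideanSpace ℝ (Fin n))) m.2 hj.symm, smul_zero]
    · intro hk
      rw [DirectSum.decompose_of_mem_same (fun i : ℕ => ⋀[ℝ]^i (EuclideanSpace ℝ (Fin n))) m.2, ext_zero n k (by simpa using hk) m m.2, smul_zero]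

lemma strace_eq (n : ℕ) (A : Module.End ℝ (ExtA n)) :
    straceExt n A = LinearMap.trace ℝ _ (epsOp n * A) := by
  rw [eps_sum, Finset.sum_mul, map_sum, straceExt]
  refine Finset.sum_congr rfl fun k _ => ?_
  rw [smul_mul_assoc, map_smul, smul_eq_mul]
  congr 1
  set p := GradedAlgebra.proj (fun i : ℕ => ⋀[ℝ]^i (EuclideanSpace ℝ (Fin n))) k with hp
  have hpp : p * p = p := by
    refine LinearMap.ext fun x => ?_
    simp only [hp, Module.End.mul_apply, GradedAlgebra.proj_apply]
    exact DirectSum.decompose_of_mem_same _ (SetLike.coe_mem _)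
  change LinearMap.trace ℝ _ (p * (A * p)) = _
  rw [LinearMap.trace_mul_comm, mul_assoc, hpp, LinearMap.trace_mul_comm]

lemma trace_zero_odd (n : ℕ) (A : Module.End ℝ (ExtA n)) (h : epsOp n * A = -(A * epsOp n)) :
    LinearMap.trace ℝ _ (epsOp n * A) = 0 := by
  have h1 := congrArg (LinearMap.trace ℝ (ExtA n)) h
  rw [map_neg, LinearMap.trace_mul_comm ℝ A] at h1
  linarith

lemma trace_zero_even (n : ℕ) (A x : Module.End ℝ (ExtA n)) (r : ℝ) (hr : r ≠ 0)
    (hx : x * x = r • 1) (he : epsOp n * x = -(x * epsOp n)) (h : x * A = A * x) :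
    LinearMap.trace ℝ _ (epsOp n * A) = 0 := by
  have h1 : epsOp n * A * x * x = r • (epsOp n * A) := by
    rw [mul_assoc _ x x, hx, mul_smul_comm, mul_one]
  have h2 : x * (epsOp n * A * x) = -(r • (epsOp n * A)) := by
    rw [← h1, ← mul_assoc, ← mul_assoc, ← neg_eq_iff_eq_neg.2 he, neg_mul, neg_mul,
      mul_assoc _ x A, h, ← mul_assoc]
  have h3 := LinearMap.trace_mul_comm ℝ x (epsOp n * A * x)
  rw [h1, h2, map_neg, map_smul, smul_eq_mul] at h3
  have : r * LinearMap.trace ℝ _ (epsOp n * A) = 0 := by linarith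
  exact (mul_eq_zero.1 this).resolve_left hr

lemma prod_one (n : ℕ) (l : List (Fin n)) :
    ((l.map (cOp n)).prod * (l.map (cHatOp n)).prod) (1 : ExtA n) =
      (-1 : ℝ) ^ (l.length * (l.length + 1) / 2) • (1 : ExtA n) := by
  induction l with
  | nil => simp
  | cons a t ih =>
    have h := aux_anti_all (cOp n) (cHatOp n a) (aux_hc n a) t
    have h1 : (cOp n a * cHatOp n a) (1 : ExtA n) = -1 := by
      have e1 : intOp n a (1 : ExtA n) = 0 := CliffordAlgebra.contractLeft_one _ _
      have e2 : cHatOp n a (1 : ExtA n) = ι ℝ (stdVec n a) := by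
        simp [cHatOp, e1, wedgeOp]
      have e3 : intOp n a (ι ℝ (stdVec n a)) = 1 := by
        have := CliffordAlgebra.contractLeft_ι (Q := (0 : QuadraticForm ℝ (EuclideanSpace ℝ (Fin n))))
          ((EuclideanSpace.basisFun (Fin n) ℝ).toBasis.coord a) (stdVec n a)
        rw [aux_coord, if_pos rfl, map_one] at this
        exact this
      rw [Module.End.mul_apply, e2, cOp, LinearMap.sub_apply, e3]
      simp [wedgeOp]
    have h2 : (t.map (cOp n)).prod * cHatOp n a =
        (-1 : ℝ) ^ t.length • (cHatOp n a * (t.map (cOp n)).prod) := by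
      rw [h, smul_smul, ← mul_pow]; simp
    have h3 : ((a :: t).map (cOp n)).prod * ((a :: t).map (cHatOp n)).prod =
        (-1 : ℝ) ^ t.length • ((cOp n a * cHatOp n a) *
          ((t.map (cOp n)).prod * (t.map (cHatOp n)).prod)) := by
      simp only [List.map_cons, List.prod_cons]
      rw [mul_assoc, ← mul_assoc _ (cHatOp n a), h2]
      simp [mul_assoc]
    have h4 : (t.length + 1) * (t.length + 1 + 1) / 2 =
        t.length * (t.length + 1) / 2 + (t.length + 1) := by
      rw [show (t.length + 1) * (t.length + 1 + 1) = t.length * (t.length + 1) + (t.length + 1) * 2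
        by ring, Nat.add_mul_div_right _ _ (by norm_num)]
    rw [h3, LinearMap.smul_apply, Module.End.mul_apply, ih, map_smul, h1, List.length_cons, h4,
      pow_add, pow_succ, smul_smul, smul_neg, mul_neg_one, mul_neg, neg_smul, mul_comm]

lemma eq_eps (n : ℕ) (P : Module.End ℝ (ExtA n)) (s : ℝ) (h1 : P 1 = s • 1)
    (h : ∀ i, wedgeOp n i * P = -(P * wedgeOp n i)) : P = s • epsOp n := by
  have hv : ∀ (v : EuclideanSpace ℝ (Fin n)) (x : ExtA n), P (ι ℝ v * x) = -(ι ℝ v * P x) := by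
    intro v x
    have hmem := (EuclideanSpace.basisFun (Fin n) ℝ).toBasis.mem_span v
    induction hmem using Submodule.span_induction with
    | zero => simp
    | add v w _ _ hv hw => rw [map_add, add_mul, map_add, hv, hw, add_mul, neg_add]
    | smul r v _ hv => rw [map_smul, smul_mul_assoc, map_smul, hv, smul_mul_assoc, smul_neg]
    | mem v hm =>
      obtain ⟨i, rfl⟩ := hm
      have := LinearMap.congr_fun (h i) x
      have h2 : (EuclideanSpace.basisFun (Fin n) ℝ).toBasis i = stdVec n i := by simp [stdVec]
      rw [h2, eq_neg_iff_add_eq_zero, ← neg_eq_iff_add_eq_zero, eq_comm]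
      exact this
  refine LinearMap.ext fun x => ?_
  induction x using CliffordAlgebra.left_induction with
  | algebraMap r =>
    change P (algebraMap ℝ (ExtA n) r) = s • epsOp n (algebraMap ℝ (ExtA n) r)
    rw [eps_algebraMap, Algebra.algebraMap_eq_smul_one, map_smul, h1, smul_comm]
  | add x y hx hy => rw [map_add, map_add, hx, hy]
  | ι_mul x v hx =>
    change P (ι ℝ v * x) = s • epsOp n (ι ℝ v * x)
    rw [hv, eps_ι_mul, hx, LinearMap.smul_apply, mul_smul_comm, smul_neg]

lemma finrank_ExtA (n : ℕ) : Module.finrank ℝ (ExtA n) = 2 ^ n := by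
  rw [Module.finrank_eq_card_basis (EuclideanSpace.basisFun (Fin n) ℝ).toBasis.ExteriorAlgebra]
  simp

lemma trace_zero_gen (n : ℕ) (I J : Finset (Fin n)) (x : Module.End ℝ (ExtA n)) (r : ℝ)
    (hr : r ≠ 0) (hx : x * x = r • 1) (he : epsOp n * x = -(x * epsOp n))
    (hI : x * cProd n I = (-1 : ℝ) ^ I.card • (cProd n I * x))
    (hJ : x * cHatProd n J = (-1 : ℝ) ^ J.card • (cHatProd n J * x)) :
    LinearMap.trace ℝ _ (epsOp n * (cProd n I * cHatProd n J)) = 0 := by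
  have h := aux_two _ _ _ _ _ hI hJ
  rw [← pow_add] at h
  rcases Nat.even_or_odd (I.card + J.card) with hp | hp
  · rw [hp.neg_one_pow, one_smul] at h
    exact trace_zero_even n _ x r hr hx he h
  · apply trace_zero_odd
    have h1 := aux_anti_all (cOp n) (epsOp n) (eps_c n) (I.sort (· ≤ ·))
    have h2 := aux_anti_all (cHatOp n) (epsOp n) (eps_h n) (J.sort (· ≤ ·))
    rw [Finset.length_sort] at h1 h2
    have h3 := aux_two _ _ _ _ _ h1 h2
    rw [← pow_add, hp.neg_one_pow, neg_one_smul] at h3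
    exact h3

lemma trace_full (n : ℕ) :
    LinearMap.trace ℝ _ (epsOp n * (cProd n Finset.univ * cHatProd n Finset.univ)) =
      (-1 : ℝ) ^ (n * (n + 1) / 2) * 2 ^ n := by
  set l := (Finset.univ : Finset (Fin n)).sort (· ≤ ·) with hl
  have hlen : l.length = n := by simp [hl]
  have hnd : l.Nodup := Finset.sort_nodup _ _
  have hmem : ∀ i, i ∈ l := by simp [hl]
  have h1 := prod_one n l
  rw [hlen] at h1
  have hsq : (-1 : ℝ) ^ n * (-1 : ℝ) ^ n = 1 := by rw [← mul_pow]; simp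
  have hc : ∀ i, cOp n i * (cProd n Finset.univ * cHatProd n Finset.univ) =
      -(cProd n Finset.univ * cHatProd n Finset.univ * cOp n i) := by
    intro i
    have a := aux_anti_mem (cOp n) (aux_cc n) i l hnd (hmem i)
    have b := aux_anti_all (cHatOp n) (cOp n i) (aux_ch n i) l
    rw [← neg_smul] at a
    have := aux_two _ _ _ _ _ a b
    rw [hlen, neg_mul, hsq, neg_one_smul] at this
    exact this
  have hh : ∀ i, cHatOp n i * (cProd n Finset.univ * cHatProd n Finset.univ) =
      -(cProd n Finset.univ * cHatProd n Finset.univ * cHatOp n i) := by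
    intro i
    have a := aux_anti_mem (cHatOp n) (aux_hh n) i l hnd (hmem i)
    have b := aux_anti_all (cOp n) (cHatOp n i) (aux_hc n i) l
    rw [← neg_smul] at a
    have := aux_two _ _ _ _ _ b a
    rw [hlen, mul_neg, hsq, neg_one_smul] at this
    exact this
  have hw : ∀ i, wedgeOp n i = (1 / 2 : ℝ) • (cOp n i + cHatOp n i) := by
    intro i
    simp only [cOp, cHatOp]
    module
  have key := eq_eps n (cProd n Finset.univ * cHatProd n Finset.univ) _ h1 (by
    intro i
    rw [hw, smul_mul_assoc, add_mul, hc, hh, mul_smul_comm, mul_add]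
    module)
  have hfin : Module.Finite ℝ (ExtA n) :=
    Module.Finite.of_basis (EuclideanSpace.basisFun (Fin n) ℝ).toBasis.ExteriorAlgebra
  rw [key, mul_smul_comm, eps_eps, map_smul, LinearMap.trace_one, finrank_ExtA]
  simp

/-- **Supertrace of Clifford–anti-Clifford products** (Proposition 5.3 of "Witten
Deformation on Non-compact Manifolds"): `tr_s(c(e_I)·ĉ(e_J))` equals
`(−1)^{n(n+1)/2}·2ⁿ` if `I = J = {1,…,n}` and `0` otherwise. -/
theorem strace_cProd_cHatProd (n : ℕ) (hn : 1 ≤ n) (I J : Finset (Fin n)) :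
    straceExt n (cProd n I * cHatProd n J) =
      if I = Finset.univ ∧ J = Finset.univ then
        (-1 : ℝ) ^ (n * (n + 1) / 2) * 2 ^ n
      else 0 := by
  rw [strace_eq]
  split_ifs with h
  · obtain ⟨rfl, rfl⟩ := h
    exact trace_full n
  · by_cases hI : I = Finset.univ
    · have hJ : J ≠ Finset.univ := fun hJ => h ⟨hI, hJ⟩
      obtain ⟨i, hi⟩ : ∃ i, i ∉ J := by
        by_contra! hc
        exact hJ (Finset.eq_univ_iff_forall.2 hc)
      have a := aux_anti_all (cOp n) (cHatOp n i) (aux_hc n i) (I.sort (· ≤ ·))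
      have b := aux_anti_notMem (cHatOp n) (aux_hh n) i (J.sort (· ≤ ·)) (by simpa using hi)
      rw [Finset.length_sort] at a b
      exact trace_zero_gen n I J (cHatOp n i) 1 (by norm_num) (by rw [aux_hh1, one_smul])
        (eps_h n i) a b
    · obtain ⟨i, hi⟩ : ∃ i, i ∉ I := by
        by_contra! hc
        exact hI (Finset.eq_univ_iff_forall.2 hc)
      have a := aux_anti_notMem (cOp n) (aux_cc n) i (I.sort (· ≤ ·)) (by simpa using hi)
      have b := aux_anti_all (cHatOp n) (cOp n i) (aux_ch n i) (J.sort (· ≤ ·))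
      rw [Finset.length_sort] at a b
      have hsq : cOp n i * cOp n i = (-1 : ℝ) • 1 := by
        rw [aux_cc1]
        exact (neg_one_smul ℝ _).symm
      exact trace_zero_gen n I J (cOp n i) (-1) (by norm_num) hsq
        (eps_c n i) a b

end
end

section
/- Let E be a finite-dimensional real inner product space, κ ∈ [0,1), c > 0, and let V : E → [0, ∞) be continuously differentiable with ‖∇V(x)‖ ≤ c·V(x)^{(κ+2)/2} for all x ∈ E. Let λ > 0, let k ≥ 2 be an integer, and let γ : [0, l] → E be a piecewise continuously differentiable unit-speed curve with V(γ(0)) = k·λ, V(γ(l)) = (k+1)·λ, and k·λ ≤ V(γ(s)) ≤ (k+1)·λ for all s ∈ [0, l]. Then ∫₀^l √(V(γ(s)) − λ) ds ≥ (1/c)·(k−1)^{1/2}·λ^{(1−κ)/2}·(k+1)^{−(κ+2)/2}. -/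
open Set

/-- `c` is a piecewise continuously differentiable curve on `[0, t]` with derivative `c'`:
it is continuous on `[0, t]`, and away from a finite set of break points it is
differentiable with continuous derivative `c'`. -/
def PiecewiseC1 {E : Type*} [NormedAddCommGroup E] [NormedSpace ℝ E]
    (c c' : ℝ → E) (t : ℝ) : Prop :=
  ContinuousOn c (Icc 0 t) ∧
    ∃ D : Finset ℝ,
      (∀ s ∈ Icc 0 t \ (D : Set ℝ), HasDerivAt c (c' s) s) ∧
      ContinuousOn c' (Icc 0 t \ (D : Set ℝ))

/-- **Agmon length estimate across an annulus of the potential** (Euclidean form of the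
estimate inside the proof of Proposition 2.3, the weak Weyl law, of "Witten Deformation on
Non-compact Manifolds"): if `‖∇V‖ ≤ c·V^{(κ+2)/2}` and `γ : [0,l] → E` is a unit-speed
piecewise `C¹` curve with `V(γ(0)) = kλ`, `V(γ(l)) = (k+1)λ` and `kλ ≤ V∘γ ≤ (k+1)λ`,
then `∫₀ˡ √(V(γ(s)) − λ) ds ≥ (1/c)·(k−1)^{1/2}·λ^{(1−κ)/2}·(k+1)^{−(κ+2)/2}`. -/
theorem agmon_annulus_estimate
    {E : Type*} [NormedAddCommGroup E] [InnerProductSpace ℝ E] [FiniteDimensional ℝ E]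
    (κ c : ℝ) (hκ0 : 0 ≤ κ) (hκ1 : κ < 1) (hc : 0 < c)
    (V : E → ℝ) (hV : ContDiff ℝ 1 V) (hV0 : ∀ x, 0 ≤ V x)
    (hgrad : ∀ x, ‖gradient V x‖ ≤ c * V x ^ ((κ + 2) / 2))
    (lam : ℝ) (hlam : 0 < lam) (k : ℕ) (hk : 2 ≤ k)
    (l : ℝ) (hl : 0 ≤ l) (γ γ' : ℝ → E) (hγ : PiecewiseC1 γ γ' l)
    (hunit : ∀ s ∈ Icc 0 l, ‖γ' s‖ = 1)
    (h0 : V (γ 0) = k * lam) (hend : V (γ l) = (k + 1) * lam)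
    (hbetween : ∀ s ∈ Icc 0 l, (k : ℝ) * lam ≤ V (γ s) ∧ V (γ s) ≤ ((k : ℝ) + 1) * lam) :
    ∫ s in (0:ℝ)..l, Real.sqrt (V (γ s) - lam)
      ≥ (1 / c) * ((k : ℝ) - 1) ^ ((1 : ℝ) / 2) * lam ^ ((1 - κ) / 2) *
          ((k : ℝ) + 1) ^ (-((κ + 2) / 2)) := by
  obtain ⟨hcont, D, hD, -⟩ := hγ
  set p := (κ + 2) / 2 with hp
  have hp0 : 0 ≤ p := by rw [hp]; linarith
  have hk' : (2 : ℝ) ≤ k := by exact_mod_cast hk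
  set M := c * (((k : ℝ) + 1) * lam) ^ p with hM
  have hpos : 0 < (((k : ℝ) + 1) * lam) := by positivity
  have hMpos : 0 < M := by positivity
  set g : ℝ → ℝ := fun s => V (γ s) with hg
  have hgc : ContinuousOn g (Icc 0 l) := hV.continuous.comp_continuousOn hcont
  have hder : ∀ s ∈ Icc 0 l \ (D : Set ℝ), HasDerivAt g (deriv g s) s ∧ ‖deriv g s‖ ≤ M := by
    intro s hs
    have hVd : DifferentiableAt ℝ V (γ s) := hV.differentiable (by norm_num) _
    have h1 : HasDerivAt g (fderiv ℝ V (γ s) (γ' s)) s :=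
      hVd.hasFDerivAt.comp_hasDerivAt s (hD s hs)
    rw [h1.deriv]
    refine ⟨h1, ?_⟩
    have h2 : ‖fderiv ℝ V (γ s)‖ = ‖gradient V (γ s)‖ := by
      rw [gradient, LinearIsometryEquiv.norm_map]
    calc ‖fderiv ℝ V (γ s) (γ' s)‖ ≤ ‖fderiv ℝ V (γ s)‖ * ‖γ' s‖ := ContinuousLinearMap.le_opNorm _ _
      _ = ‖gradient V (γ s)‖ := by rw [hunit s hs.1, mul_one, h2]
      _ ≤ c * V (γ s) ^ p := hgrad _
      _ ≤ M := by
        rw [hM]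
        have := (hbetween s hs.1).2
        have := hV0 (γ s)
        gcongr
  have hae : ∀ᵐ s ∂(MeasureTheory.volume : MeasureTheory.Measure ℝ),
      s ∈ uIoc 0 l → ‖deriv g s‖ ≤ M := by
    have h3 : ∀ᵐ s ∂(MeasureTheory.volume : MeasureTheory.Measure ℝ), s ∉ (D : Set ℝ) :=
      D.countable_toSet.ae_notMem _
    filter_upwards [h3] with s hs hs2
    rw [uIoc_of_le hl] at hs2
    exact (hder s ⟨⟨hs2.1.le, hs2.2⟩, hs⟩).2
  have hint : IntervalIntegrable (deriv g) MeasureTheory.volume 0 l := by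
    refine IntervalIntegrable.mono_fun (intervalIntegrable_const (c := M))
      (measurable_deriv g).aestronglyMeasurable ?_
    rw [Filter.EventuallyLE, MeasureTheory.ae_restrict_iff' measurableSet_uIoc]
    filter_upwards [hae] with s hs hs2
    exact (hs hs2).trans (le_abs_self M)
  have hftc : ∫ s in (0:ℝ)..l, deriv g s = g l - g 0 :=
    MeasureTheory.integral_eq_of_hasDerivAt_off_countable_of_le g (deriv g) hl
      D.countable_toSet hgc
      (fun s hs => (hder s ⟨⟨hs.1.1.le, hs.1.2.le⟩, hs.2⟩).1) hint
  have hlen : lam ≤ M * l := by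
    have h4 := intervalIntegral.norm_integral_le_of_norm_le_const_ae hae
    rw [hftc, sub_zero, abs_of_nonneg hl, Real.norm_eq_abs] at h4
    have h5 : g l - g 0 = lam := by
      simp only [hg, h0, hend]; ring
    rw [h5, abs_of_pos hlam] at h4
    exact h4
  have hlow : Real.sqrt (((k : ℝ) - 1) * lam) * l ≤
      ∫ s in (0:ℝ)..l, Real.sqrt (V (γ s) - lam) := by
    have h6 : ∫ s in (0:ℝ)..l, Real.sqrt (((k : ℝ) - 1) * lam)
        = Real.sqrt (((k : ℝ) - 1) * lam) * l := by
      rw [intervalIntegral.integral_const, smul_eq_mul, sub_zero, mul_comm]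
    rw [← h6]
    refine intervalIntegral.integral_mono_on hl intervalIntegrable_const ?_ ?_
    · apply ContinuousOn.intervalIntegrable
      rw [uIcc_of_le hl]
      exact (hgc.sub continuousOn_const).sqrt
    · intro s hs
      apply Real.sqrt_le_sqrt
      have := (hbetween s hs).1
      linarith
  have hl2 : lam / M ≤ l := by rw [div_le_iff₀ hMpos]; linarith
  refine ge_iff_le.mpr (le_trans ?_ hlow)
  refine le_trans (le_of_eq ?_) (mul_le_mul_of_nonneg_left hl2 (Real.sqrt_nonneg _))
  have hk1 : (0:ℝ) ≤ (k:ℝ) - 1 := by linarith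
  have hk2 : (0:ℝ) < (k:ℝ) + 1 := by linarith
  rw [hM, Real.sqrt_eq_rpow, Real.mul_rpow hk1 hlam.le, Real.mul_rpow hk2.le hlam.le,
    Real.rpow_neg hk2.le]
  have h7 : lam ^ ((1 - κ) / 2) * lam ^ p = lam ^ ((1:ℝ) / 2) * lam := by
    rw [← Real.rpow_add hlam, ← Real.rpow_add_one hlam.ne']
    congr 1; rw [hp]; ring
  have h8 : lam ^ ((1 - κ) / 2) = lam ^ ((1:ℝ) / 2) * lam / lam ^ p := by
    rw [← h7]; field_simp
  rw [h8]
  field_simp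
end
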